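/- There exists a universal constant C > 0 such that for every n ≥ 2 and every choice of nonnegative reals b_1^2,...,b_n^2 with Σ_{k=1}^n b_k^2 = n, if θ is uniformly distributed on the unit sphere S^{n-1} of R^n and V_n^2(θ) = Σ_{k=1}^n θ_k^2 b_k^2, then sup_{t∈R} | E[Φ(t / V_n(θ))] − Φ(t) | ≤ C (1 + α_n (log n)^2)/n, where α_n is any real with α_n ≥ b_k^4 for all 1 ≤ k ≤ n, Φ(t/V_n(θ)) denotes the distribution function at t of a centered Gaussian with variance V_n^2(θ), and Φ is the standard normal distribution function. -/

import Mathlib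

open MeasureTheory ProbabilityTheory Finset
open scoped NNReal ENNReal

/-- The uniform (rotation invariant) probability measure on the unit sphere
`S^{n-1}` of `ℝ^n`, obtained by normalizing the spherical part of the Lebesgue
measure. -/
noncomputable def sphereUniform (n : ℕ) :
    Measure (Metric.sphere (0 : EuclideanSpace ℝ (Fin n)) 1) :=
  ((volume : Measure (EuclideanSpace ℝ (Fin n))).toSphere Set.univ)⁻¹ •
    (volume : Measure (EuclideanSpace ℝ (Fin n))).toSphere

/-- The distribution function at `t` of a centered Gaussian random variable
with variance `v` (for `v = 0` this is the distribution function of the Dirac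
mass at `0`). -/
noncomputable def gaussCDF (v : ℝ≥0) (t : ℝ) : ℝ :=
  ((gaussianReal 0 v) (Set.Iic t)).toReal

open scoped RealInnerProductSpace Pointwise

section Sphere

variable {n : ℕ}

theorem isProbabilityMeasure_sphereUniform (hn : n ≠ 0) :
    IsProbabilityMeasure (sphereUniform n) := by
  have : Nonempty (Fin n) := ⟨⟨0, Nat.pos_of_ne_zero hn⟩⟩
  refine ⟨?_⟩
  rw [sphereUniform, Measure.smul_apply, smul_eq_mul]
  refine ENNReal.inv_mul_cancel ?_ (measure_ne_top _ _)
  rw [Ne, Measure.measure_univ_eq_zero]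
  exact Measure.toSphere_ne_zero _

/-- The image in `ℝ^n` of the uniform measure on the sphere is invariant under linear isometries. -/
theorem map_sphereUniform_map_linearIsometryEquiv
    (L : EuclideanSpace ℝ (Fin n) ≃ₗᵢ[ℝ] EuclideanSpace ℝ (Fin n)) :
    ((sphereUniform n).map Subtype.val).map L = (sphereUniform n).map Subtype.val := by
  have hL : Measurable L := L.continuous.measurable
  ext s hs
  rw [Measure.map_apply hL hs, Measure.map_apply measurable_subtype_coe hs,
    Measure.map_apply measurable_subtype_coe (hL hs), sphereUniform, Measure.smul_apply,
    Measure.smul_apply, Measure.toSphere_apply' _ (measurable_subtype_coe hs),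
    Measure.toSphere_apply' _ (measurable_subtype_coe (hL hs))]
  congr 2
  symm
  rw [← L.measurePreserving.measure_preimage_equiv (f := L.toMeasurableEquiv)]
  congr 1
  ext x
  simp only [Set.mem_smul, Set.mem_image, Set.mem_preimage, Subtype.exists, mem_sphere_zero_iff_norm,
    LinearIsometryEquiv.coe_toMeasurableEquiv]
  constructor
  · rintro ⟨c, hc, y, ⟨z, hz, hzs, rfl⟩, hx⟩
    refine ⟨c, hc, L.symm z, ⟨L.symm z, by simpa using hz, by simpa using hzs, rfl⟩, ?_⟩
    apply L.injective
    simpa using hx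
  · rintro ⟨c, hc, y, ⟨z, hz, hzs, rfl⟩, rfl⟩
    exact ⟨c, hc, L z, ⟨L z, by simpa using hz, hzs, rfl⟩, by simp⟩

/-- One-dimensional marginals of the uniform measure on the sphere depend only on the norm of the
direction. -/
theorem integral_sphereUniform_inner_eq {x y : EuclideanSpace ℝ (Fin n)} (h : ‖x‖ = ‖y‖)
    {f : ℝ → ℝ} (hf : Continuous f) :
    ∫ u, f ⟪x, (u : EuclideanSpace ℝ (Fin n))⟫ ∂sphereUniform n =
      ∫ u, f ⟪y, (u : EuclideanSpace ℝ (Fin n))⟫ ∂sphereUniform n := by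
  have hc (z : EuclideanSpace ℝ (Fin n)) : Continuous fun v ↦ f ⟪z, v⟫ := by fun_prop
  have hm (z : EuclideanSpace ℝ (Fin n)) :=
    integral_map (μ := sphereUniform n) measurable_subtype_coe.aemeasurable
      (hc z).aestronglyMeasurable
  set L := (ℝ ∙ (x - y))ᗮ.reflection
  have hL : L x = y := Submodule.reflection_sub h
  rw [← hm, ← hm, ← map_sphereUniform_map_linearIsometryEquiv L,
    integral_map L.continuous.measurable.aemeasurable (hc y).aestronglyMeasurable,
    map_sphereUniform_map_linearIsometryEquiv L]
  simp_rw [← hL, L.inner_map_map]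

theorem Continuous.integrable_sphereUniform (hn : n ≠ 0)
    {f : Metric.sphere (0 : EuclideanSpace ℝ (Fin n)) 1 → ℝ} (hf : Continuous f) :
    Integrable f (sphereUniform n) := by
  have := isProbabilityMeasure_sphereUniform hn
  exact hf.integrable_of_hasCompactSupport (HasCompactSupport.of_compactSpace f)

theorem sum_sq_sphere (u : Metric.sphere (0 : EuclideanSpace ℝ (Fin n)) 1) :
    ∑ k, (u : EuclideanSpace ℝ (Fin n)) k ^ 2 = 1 := by
  have := EuclideanSpace.real_norm_sq_eq (u : EuclideanSpace ℝ (Fin n))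
  rw [← this, norm_eq_of_mem_sphere u, one_pow]

theorem integral_sphereUniform_sq (hn : n ≠ 0) (k : Fin n) :
    ∫ u, (u : EuclideanSpace ℝ (Fin n)) k ^ 2 ∂sphereUniform n = 1 / n := by
  have := isProbabilityMeasure_sphereUniform hn
  have hs : ∑ j, ∫ u, (u : EuclideanSpace ℝ (Fin n)) j ^ 2 ∂sphereUniform n = 1 := by
    rw [← integral_finsetSum _ fun j _ ↦ Continuous.integrable_sphereUniform hn (by fun_prop)]
    simp [sum_sq_sphere]
  have he (j : Fin n) : ∫ u, (u : EuclideanSpace ℝ (Fin n)) j ^ 2 ∂sphereUniform n =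
      ∫ u, (u : EuclideanSpace ℝ (Fin n)) k ^ 2 ∂sphereUniform n := by
    simpa [EuclideanSpace.inner_single_left] using
      integral_sphereUniform_inner_eq (x := EuclideanSpace.single j (1 : ℝ))
        (y := EuclideanSpace.single k (1 : ℝ)) (by simp) (continuous_pow 2)
  rw [Finset.sum_congr rfl fun j _ ↦ he j] at hs
  have : (n : ℝ) ≠ 0 := by exact_mod_cast hn
  field_simp
  simpa [mul_comm] using hs

/-- Up to the common factor `m`, the mixed fourth moments of the uniform measure on the sphere are
those of a Gaussian vector. -/
theorem integral_sphereUniform_sq_mul_sq_aux (hn : n ≠ 0) :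
    ∃ m : ℝ, ∀ j k : Fin n,
      ∫ u, (u : EuclideanSpace ℝ (Fin n)) j ^ 2 * (u : EuclideanSpace ℝ (Fin n)) k ^ 2
        ∂sphereUniform n = m * (1 + if j = k then 2 else 0) := by
  let e (k : Fin n) := EuclideanSpace.single k (1 : ℝ)
  let M (x : EuclideanSpace ℝ (Fin n)) : ℝ :=
    ∫ u, ⟪x, (u : EuclideanSpace ℝ (Fin n))⟫ ^ 4 ∂sphereUniform n
  have hM {x y : EuclideanSpace ℝ (Fin n)} (h : ‖x‖ = ‖y‖) : M x = M y :=
    integral_sphereUniform_inner_eq h (continuous_pow 4)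
  have hM2 (x : EuclideanSpace ℝ (Fin n)) (c : ℝ) : M (c • x) = c ^ 4 * M x := by
    simp only [M, inner_smul_left, mul_pow, integral_const_mul]
    simp
  have hint (x : EuclideanSpace ℝ (Fin n)) : Integrable
      (fun u : Metric.sphere (0 : EuclideanSpace ℝ (Fin n)) 1 ↦
        ⟪x, (u : EuclideanSpace ℝ (Fin n))⟫ ^ 4) (sphereUniform n) :=
    Continuous.integrable_sphereUniform hn (by fun_prop)
  let k₀ : Fin n := ⟨0, Nat.pos_of_ne_zero hn⟩
  refine ⟨M (e k₀) / 3, fun j k ↦ ?_⟩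
  have hj (j : Fin n) : M (e j) = M (e k₀) := hM (by simp [e])
  by_cases h : j = k
  · subst h
    rw [if_pos rfl, ← hj j]
    have : M (e j) = ∫ u, (u : EuclideanSpace ℝ (Fin n)) j ^ 2 *
        (u : EuclideanSpace ℝ (Fin n)) j ^ 2 ∂sphereUniform n := by
      simp only [M, e, EuclideanSpace.inner_single_left]
      congr 1 with u
      simp
      ring
    rw [← this]
    ring
  · have hn2 (s : ℝ) (hs : s ^ 2 = 1) : ‖e j + s • e k‖ = ‖√2 • e k₀‖ := by
      rw [← sq_eq_sq₀ (norm_nonneg _) (norm_nonneg _), norm_add_sq_real]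
      simp [e, norm_smul, hs, inner_smul_right, EuclideanSpace.inner_single_left, h]
      norm_num
    have h2 : √2 ^ 4 = (4 : ℝ) := by
      rw [show 4 = 2 * 2 from rfl, pow_mul, Real.sq_sqrt (by norm_num)]; norm_num
    have hp (s : ℝ) (hs : s ^ 2 = 1) : M (e j + s • e k) = 4 * M (e k₀) := by
      rw [hM (hn2 s hs), hM2, h2]
    have hkey : ∀ u : Metric.sphere (0 : EuclideanSpace ℝ (Fin n)) 1,
        (u : EuclideanSpace ℝ (Fin n)) j ^ 2 * (u : EuclideanSpace ℝ (Fin n)) k ^ 2 =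
        (1 / 12) * (⟪e j + (1 : ℝ) • e k, (u : EuclideanSpace ℝ (Fin n))⟫ ^ 4 +
          ⟪e j + (-1 : ℝ) • e k, (u : EuclideanSpace ℝ (Fin n))⟫ ^ 4 -
          2 * ⟪e j, (u : EuclideanSpace ℝ (Fin n))⟫ ^ 4 -
          2 * ⟪e k, (u : EuclideanSpace ℝ (Fin n))⟫ ^ 4) := by
      intro u
      simp only [e, inner_add_left, inner_smul_left, EuclideanSpace.inner_single_left]
      simp
      ring
    simp_rw [hkey]
    rw [integral_const_mul,
      integral_sub (Continuous.integrable_sphereUniform hn (by fun_prop)) ((hint _).const_mul _),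
      integral_sub ((hint _).fun_add (hint _)) ((hint _).const_mul _),
      integral_add (hint _) (hint _), integral_const_mul, integral_const_mul]
    change 1 / 12 * (M (e j + (1 : ℝ) • e k) + M (e j + (-1 : ℝ) • e k) - 2 * M (e j) -
      2 * M (e k)) = _
    rw [hp 1 (by norm_num), hp (-1) (by norm_num), hj j, hj k, if_neg h]
    ring

theorem integral_sphereUniform_sq_mul_sq (hn : n ≠ 0) (j k : Fin n) :
    ∫ u, (u : EuclideanSpace ℝ (Fin n)) j ^ 2 * (u : EuclideanSpace ℝ (Fin n)) k ^ 2
      ∂sphereUniform n = (1 + if j = k then 2 else 0) / (n * (n + 2)) := by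
  have := isProbabilityMeasure_sphereUniform hn
  obtain ⟨m, hm⟩ := integral_sphereUniform_sq_mul_sq_aux hn
  have hs : ∑ j, ∑ k, ∫ u, (u : EuclideanSpace ℝ (Fin n)) j ^ 2 *
      (u : EuclideanSpace ℝ (Fin n)) k ^ 2 ∂sphereUniform n = 1 := by
    have hi (j k : Fin n) : Integrable
        (fun u : Metric.sphere (0 : EuclideanSpace ℝ (Fin n)) 1 ↦
          (u : EuclideanSpace ℝ (Fin n)) j ^ 2 * (u : EuclideanSpace ℝ (Fin n)) k ^ 2)
        (sphereUniform n) :=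
      Continuous.integrable_sphereUniform hn (by fun_prop)
    simp_rw [← integral_finsetSum _ fun k _ ↦ hi _ k]
    rw [← integral_finsetSum _ fun j _ ↦ integrable_finsetSum _ fun k _ ↦ hi j k]
    simp_rw [← Finset.sum_mul_sum, sum_sq_sphere]
    simp
  simp_rw [hm, ← Finset.mul_sum, Finset.sum_add_distrib] at hs
  simp at hs
  have : (n : ℝ) ≠ 0 := by exact_mod_cast hn
  rw [hm, eq_div_iff (by positivity)]
  linear_combination (1 + if j = k then (2 : ℝ) else 0) * hs

theorem integral_sphereUniform_sum_sq_mul (hn : n ≠ 0) (c : Fin n → ℝ) :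
    ∫ u, ∑ k, (u : EuclideanSpace ℝ (Fin n)) k ^ 2 * c k ∂sphereUniform n = (∑ k, c k) / n := by
  rw [integral_finsetSum _ fun j _ ↦ Continuous.integrable_sphereUniform hn (by fun_prop)]
  simp_rw [integral_mul_const, integral_sphereUniform_sq hn, ← Finset.mul_sum]
  ring

theorem integral_sphereUniform_sum_sq_mul_sq (hn : n ≠ 0) (c : Fin n → ℝ) :
    ∫ u, (∑ k, (u : EuclideanSpace ℝ (Fin n)) k ^ 2 * c k) ^ 2 ∂sphereUniform n =
      ((∑ k, c k) ^ 2 + 2 * ∑ k, c k ^ 2) / (n * (n + 2)) := by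
  have hi (j k : Fin n) : Integrable
      (fun u : Metric.sphere (0 : EuclideanSpace ℝ (Fin n)) 1 ↦
        ((u : EuclideanSpace ℝ (Fin n)) j ^ 2 * (u : EuclideanSpace ℝ (Fin n)) k ^ 2) *
          (c j * c k))
      (sphereUniform n) :=
    Continuous.integrable_sphereUniform hn (by fun_prop)
  have hexp (u : Metric.sphere (0 : EuclideanSpace ℝ (Fin n)) 1) :
      (∑ k, (u : EuclideanSpace ℝ (Fin n)) k ^ 2 * c k) ^ 2 =
      ∑ j, ∑ k, ((u : EuclideanSpace ℝ (Fin n)) j ^ 2 * (u : EuclideanSpace ℝ (Fin n)) k ^ 2) *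
          (c j * c k) := by
    rw [sq, Finset.sum_mul_sum]
    exact Finset.sum_congr rfl fun j _ ↦ Finset.sum_congr rfl fun k _ ↦ by ring
  simp_rw [hexp]
  rw [integral_finsetSum _ fun j _ ↦ integrable_finsetSum _ fun k _ ↦ hi j k]
  simp_rw [integral_finsetSum _ fun k _ ↦ hi _ k, integral_mul_const,
    integral_sphereUniform_sq_mul_sq hn]
  simp_rw [div_mul_eq_mul_div, ← Finset.sum_div, add_mul, one_mul, Finset.sum_add_distrib, ite_mul,
    zero_mul, Finset.sum_ite_eq, Finset.mem_univ, if_true, sq, Finset.sum_mul_sum, Finset.mul_sum]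

end Sphere

section Gaussian

theorem gaussCDF_nonneg (v : ℝ≥0) (t : ℝ) : 0 ≤ gaussCDF v t := ENNReal.toReal_nonneg

theorem gaussCDF_le_one (v : ℝ≥0) (t : ℝ) : gaussCDF v t ≤ 1 :=
  measureReal_le_one (μ := gaussianReal 0 v) (s := Set.Iic t)

theorem abs_gaussCDF_sub_le_one (v w : ℝ≥0) (s t : ℝ) : |gaussCDF v s - gaussCDF w t| ≤ 1 := by
  rw [abs_le]
  constructor <;>
  linarith [gaussCDF_nonneg v s, gaussCDF_nonneg w t, gaussCDF_le_one v s, gaussCDF_le_one w t]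

theorem gaussCDF_eq_gaussCDF_one {v : ℝ} (hv : 0 < v) (t : ℝ) :
    gaussCDF v.toNNReal t = gaussCDF 1 (t * (√v)⁻¹) := by
  have hr : 0 < √v := Real.sqrt_pos.2 hv
  have h := gaussianReal_map_const_mul (μ := 0) (v := 1) (√v)
  have hv' : NNReal.mk (√v ^ 2) (sq_nonneg _) * 1 = v.toNNReal := by
    ext
    simp [Real.sq_sqrt hv.le, hv.le]
  rw [hv', mul_zero] at h
  rw [gaussCDF, gaussCDF, ← h, Measure.map_apply (by fun_prop) measurableSet_Iic]
  congr 2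
  ext x
  simp only [Set.mem_preimage, Set.mem_Iic, ← div_eq_mul_inv, le_div_iff₀ hr, mul_comm]

theorem monotone_gaussCDF (v : ℝ≥0) : Monotone (gaussCDF v) := fun _ _ h ↦
  measureReal_mono (μ := gaussianReal 0 v) (Set.Iic_subset_Iic.2 h)

theorem measurable_gaussCDF_toNNReal (t : ℝ) : Measurable fun v : ℝ ↦ gaussCDF v.toNNReal t := by
  have h : (fun v : ℝ ↦ gaussCDF v.toNNReal t) =
      fun v ↦ if 0 < v then gaussCDF 1 (t * (√v)⁻¹) else gaussCDF 0 t := by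
    ext v
    split_ifs with hv
    · exact gaussCDF_eq_gaussCDF_one hv t
    · rw [Real.toNNReal_of_nonpos (not_lt.1 hv)]
  rw [h]
  exact Measurable.ite measurableSet_Ioi
    ((monotone_gaussCDF 1).measurable.comp (by fun_prop)) measurable_const

theorem hasDerivAt_gaussianPDFReal_zero_one (x : ℝ) :
    HasDerivAt (gaussianPDFReal 0 1) (-x * gaussianPDFReal 0 1 x) x := by
  have h : HasDerivAt (fun x : ℝ ↦ -(x - 0) ^ 2 / (2 * ((1 : ℝ≥0) : ℝ))) (-x) x := by
    have := ((hasDerivAt_pow 2 x).div_const 2).neg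
    refine (this.congr_deriv (by simp)).congr_of_eventuallyEq (.of_forall fun y ↦ ?_)
    simp only [sub_zero, NNReal.coe_one, Pi.neg_apply]
    ring
  have h2 := h.exp.const_mul (√(2 * Real.pi * ((1 : ℝ≥0) : ℝ)))⁻¹
  rw [gaussianPDFReal_def]
  refine h2.congr_deriv ?_
  simp only
  ring

theorem hasDerivAt_gaussCDF_one (x : ℝ) :
    HasDerivAt (gaussCDF 1) (gaussianPDFReal 0 1 x) x := by
  have hc : Continuous (gaussianPDFReal 0 1) :=
    continuous_iff_continuousAt.2 fun x ↦ (hasDerivAt_gaussianPDFReal_zero_one x).continuousAt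
  have he : gaussCDF 1 = fun y ↦ gaussCDF 1 0 + ∫ s in (0 : ℝ)..y, gaussianPDFReal 0 1 s := by
    have hI (z : ℝ) : gaussCDF 1 z = ∫ s in Set.Iic z, gaussianPDFReal 0 1 s := by
      rw [gaussCDF, gaussianReal_apply_eq_integral _ one_ne_zero, ENNReal.toReal_ofReal]
      exact integral_nonneg fun _ ↦ gaussianPDFReal_nonneg _ _ _
    ext y
    rw [← intervalIntegral.integral_Iic_sub_Iic (integrable_gaussianPDFReal 0 1).integrableOn
      (integrable_gaussianPDFReal 0 1).integrableOn, ← hI, ← hI]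
    ring
  rw [he]
  exact (intervalIntegral.integral_hasDerivAt_right (hc.intervalIntegrable _ _)
    hc.aestronglyMeasurable.stronglyMeasurableAtFilter hc.continuousAt).const_add _

theorem gaussianPDFReal_zero_one_le (x : ℝ) :
    gaussianPDFReal 0 1 x ≤ (Real.exp (x ^ 2 / 2))⁻¹ := by
  rw [gaussianPDFReal, ← Real.exp_neg]
  have h1 : (√(2 * Real.pi * ((1 : ℝ≥0) : ℝ)))⁻¹ ≤ 1 := by
    apply inv_le_one_of_one_le₀
    rw [Real.one_le_sqrt]
    simp only [NNReal.coe_one]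
    linarith [Real.pi_gt_three]
  have h2 : -(x - 0) ^ 2 / (2 * ((1 : ℝ≥0) : ℝ)) = -(x ^ 2 / 2) := by simp; ring
  rw [h2]
  exact mul_le_of_le_one_left (Real.exp_pos _).le h1

theorem abs_mul_gaussianPDFReal_zero_one_le (x : ℝ) : |x * gaussianPDFReal 0 1 x| ≤ 1 := by
  have hx := abs_nonneg x
  have hs := sq_abs x
  rw [abs_mul, abs_of_nonneg (gaussianPDFReal_nonneg _ _ _)]
  refine (mul_le_mul_of_nonneg_left (gaussianPDFReal_zero_one_le x) hx).trans ?_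
  rw [← div_eq_mul_inv, div_le_one (Real.exp_pos _)]
  have := Real.add_one_le_exp (x ^ 2 / 2)
  nlinarith [sq_nonneg (|x| - 1)]

theorem abs_pow_three_mul_gaussianPDFReal_zero_one_le (x : ℝ) :
    |x| ^ 3 * gaussianPDFReal 0 1 x ≤ 4 := by
  have hx := abs_nonneg x
  have hs := sq_abs x
  refine (mul_le_mul_of_nonneg_left (gaussianPDFReal_zero_one_le x) (by positivity)).trans ?_
  rw [← div_eq_mul_inv, div_le_iff₀ (Real.exp_pos _)]
  have := Real.quadratic_le_exp_of_nonneg (x := x ^ 2 / 2) (by positivity)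
  rw [← hs] at this ⊢
  nlinarith [mul_nonneg (sq_nonneg |x|) (sq_nonneg (|x| - 1)), sq_nonneg |x|]

/-- First-order Taylor expansion of the standard normal distribution function under scaling. -/
theorem abs_gaussCDF_mul_sub_le (t : ℝ) {w : ℝ} (hw : 1 / 2 ≤ w) :
    |gaussCDF 1 (t * w) - gaussCDF 1 t - t * gaussianPDFReal 0 1 t * (w - 1)| ≤
      16 * (w - 1) ^ 2 := by
  have hlow {x : ℝ} (hx : x ∈ Set.uIcc 1 w) : 1 / 2 ≤ x :=
    (le_min (by norm_num) hw).trans hx.1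
  have hlin (x : ℝ) : HasDerivAt (fun x : ℝ ↦ t * x) t x := by
    simpa using (hasDerivAt_id x).const_mul t
  have hd1 {x : ℝ} (hx : x ∈ Set.uIcc 1 w) :
      |t * gaussianPDFReal 0 1 (t * x) - t * gaussianPDFReal 0 1 (t * 1)| ≤ 16 * |x - 1| := by
    refine Convex.norm_image_sub_le_of_norm_hasDerivWithin_le (s := Set.uIcc 1 w)
      (f := fun y ↦ t * gaussianPDFReal 0 1 (t * y))
      (fun y _ ↦ (((hasDerivAt_gaussianPDFReal_zero_one (t * y)).comp y
        (hlin y)).const_mul t).hasDerivWithinAt) (fun y hy ↦ ?_) (convex_uIcc 1 w)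
      Set.left_mem_uIcc hx
    have hy2 := hlow hy
    have h4 := abs_pow_three_mul_gaussianPDFReal_zero_one_le (t * y)
    have hp := gaussianPDFReal_nonneg 0 1 (t * y)
    rw [Real.norm_eq_abs, abs_mul, abs_mul, abs_mul, abs_neg, abs_of_nonneg hp]
    rw [abs_mul, abs_of_nonneg (by linarith : 0 ≤ y)] at *
    have hq : 0 ≤ |t| ^ 3 * y * gaussianPDFReal 0 1 (t * y) := by positivity
    have : 1 / 4 ≤ y ^ 2 := by nlinarith
    nlinarith [mul_le_mul_of_nonneg_right this hq]
  have := Convex.norm_image_sub_le_of_norm_hasDerivWithin_le (s := Set.uIcc 1 w)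
      (f := fun y ↦ gaussCDF 1 (t * y) - t * gaussianPDFReal 0 1 (t * 1) * y)
      (f' := fun y ↦ t * gaussianPDFReal 0 1 (t * y) - t * gaussianPDFReal 0 1 (t * 1))
      (C := 16 * |w - 1|)
      (fun y _ ↦ ?_) (fun y hy ↦ ?_) (convex_uIcc 1 w)
      Set.left_mem_uIcc Set.right_mem_uIcc
  · rw [Real.norm_eq_abs, Real.norm_eq_abs, mul_assoc 16, ← sq, sq_abs] at this
    convert this using 2
    simp only [mul_one]
    ring
  · have h := ((hasDerivAt_gaussCDF_one (t * y)).comp y (hlin y)).sub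
      ((hasDerivAt_id y).const_mul (t * gaussianPDFReal 0 1 (t * 1)))
    rw [mul_one (t * _), mul_comm _ t] at h
    exact h.hasDerivWithinAt
  · refine (hd1 hy).trans ?_
    exact mul_le_mul_of_nonneg_left (Set.abs_sub_left_of_mem_uIcc hy) (by norm_num)

/-- First-order Taylor expansion at `1`, with a global remainder uniform in `t`, of the Gaussian
distribution function in terms of the variance. -/
theorem abs_gaussCDF_toNNReal_sub_le (t : ℝ) {v : ℝ} (hv : 0 ≤ v) :
    |gaussCDF v.toNNReal t - gaussCDF 1 t + t * gaussianPDFReal 0 1 t / 2 * (v - 1)| ≤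
      66 * (v - 1) ^ 2 := by
  set κ := t * gaussianPDFReal 0 1 t
  have hκ : |κ| ≤ 1 := abs_mul_gaussianPDFReal_zero_one_le t
  by_cases hfar : 3 / 4 ≤ |v - 1|
  · calc _ ≤ |gaussCDF v.toNNReal t - gaussCDF 1 t| + |κ / 2 * (v - 1)| := abs_add_le _ _
      _ ≤ 1 + 1 / 2 * |v - 1| := by
        rw [abs_mul, abs_div, abs_two]
        gcongr
        exact abs_gaussCDF_sub_le_one _ _ _ _
      _ ≤ 66 * (v - 1) ^ 2 := by
        rw [← sq_abs (v - 1)]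
        nlinarith
  · obtain ⟨h1, h2⟩ := abs_lt.1 (not_le.1 hfar)
    have hv0 : 0 < v := by linarith
    rw [gaussCDF_eq_gaussCDF_one hv0]
    set r := √v
    have hvr : v = r ^ 2 := (Real.sq_sqrt hv).symm
    have hr0 : 0 ≤ r := Real.sqrt_nonneg _
    have hr1 : 1 / 2 ≤ r := by nlinarith
    have hr2 : r ≤ 2 := by nlinarith
    have hw := abs_gaussCDF_mul_sub_le t (w := r⁻¹) (by
      rw [one_div]; exact inv_anti₀ (by linarith) hr2)
    have hinv : r⁻¹ ≤ 2 := by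
      have := inv_anti₀ (by norm_num) hr1
      simpa using this
    have hinv0 : 0 ≤ r⁻¹ := inv_nonneg.2 hr0
    have hrr : r * r⁻¹ = 1 := mul_inv_cancel₀ (by linarith)
    have e1 : (r⁻¹ - 1) ^ 2 = (r - 1) ^ 2 * r⁻¹ ^ 2 := by
      linear_combination (-r * r⁻¹ + 2 * r⁻¹ - 1) * hrr
    have e2 : r⁻¹ - 1 + (v - 1) / 2 = (r - 1) ^ 2 * (r⁻¹ + 1 / 2) := by
      rw [hvr]
      linear_combination (2 - r) * hrr
    have hsq : (v - 1) ^ 2 = (r - 1) ^ 2 * (r + 1) ^ 2 := by rw [hvr]; ring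
    calc _ = |(gaussCDF 1 (t * r⁻¹) - gaussCDF 1 t - κ * (r⁻¹ - 1)) +
          κ * (r⁻¹ - 1 + (v - 1) / 2)| := by congr 1; ring
      _ ≤ 16 * (r⁻¹ - 1) ^ 2 + 1 * |r⁻¹ - 1 + (v - 1) / 2| := by
        refine (abs_add_le _ _).trans ?_
        rw [abs_mul]
        gcongr
      _ = (r - 1) ^ 2 * (16 * r⁻¹ ^ 2 + r⁻¹ + 1 / 2) := by
        rw [e2, e1, abs_of_nonneg (by positivity)]
        ring
      _ ≤ (r - 1) ^ 2 * (66 * (r + 1) ^ 2) := by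
        gcongr
        nlinarith
      _ = _ := by rw [hsq]; ring

end Gaussian

/-- Comparison without logarithmic factor, pointwise in `t`. -/
theorem abs_integral_gaussCDF_sub_le {n : ℕ} (hn : n ≠ 0) {b : Fin n → ℝ} (hb : ∀ k, 0 ≤ b k)
    (hsum : ∑ k, b k = n) (t : ℝ) :
    |(∫ u, gaussCDF (Real.toNNReal (∑ k, (u : EuclideanSpace ℝ (Fin n)) k ^ 2 * b k)) t
      ∂sphereUniform n) - gaussCDF 1 t| ≤ 132 * (∑ k, b k ^ 2) / (n * (n + 2)) := by
  have := isProbabilityMeasure_sphereUniform hn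
  set κ := t * gaussianPDFReal 0 1 t / 2
  let V (u : Metric.sphere (0 : EuclideanSpace ℝ (Fin n)) 1) : ℝ :=
    ∑ k, (u : EuclideanSpace ℝ (Fin n)) k ^ 2 * b k
  have hVc : Continuous V := by fun_prop
  have hV0 (u) : 0 ≤ V u := Finset.sum_nonneg fun k _ ↦ mul_nonneg (sq_nonneg _) (hb k)
  have hV1 (u) : V u - 1 = ∑ k, (u : EuclideanSpace ℝ (Fin n)) k ^ 2 * (b k - 1) := by
    simp_rw [mul_sub, Finset.sum_sub_distrib, mul_one, sum_sq_sphere, V]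
  have hc : ∑ k, (b k - 1) = 0 := by simp [hsum]
  have hmean : ∫ u, (V u - 1) ∂sphereUniform n = 0 := by
    simp_rw [hV1, integral_sphereUniform_sum_sq_mul hn, hc, zero_div]
  have hvar : ∫ u, (V u - 1) ^ 2 ∂sphereUniform n ≤ 2 * (∑ k, b k ^ 2) / (n * (n + 2)) := by
    simp_rw [hV1, integral_sphereUniform_sum_sq_mul_sq hn, hc]
    have : ∑ k, (b k - 1) ^ 2 = ∑ k, b k ^ 2 - n := by
      simp_rw [sub_sq, Finset.sum_add_distrib, Finset.sum_sub_distrib, mul_one, ← Finset.mul_sum,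
        hsum]
      simp
      ring
    rw [this]
    gcongr
    have : (0 : ℝ) ≤ n := n.cast_nonneg
    linarith
  have hg : Integrable (fun u ↦ gaussCDF (V u).toNNReal t) (sphereUniform n) := by
    refine Integrable.of_bound (C := 1)
      ((measurable_gaussCDF_toNNReal t).comp hVc.measurable).aestronglyMeasurable
      (Filter.Eventually.of_forall fun u ↦ ?_)
    rw [Real.norm_eq_abs, abs_of_nonneg (gaussCDF_nonneg _ _)]
    exact gaussCDF_le_one _ _
  have hlin : Integrable (fun u ↦ κ * (V u - 1)) (sphereUniform n) :=
    Continuous.integrable_sphereUniform hn (by fun_prop)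
  have heq : (∫ u, gaussCDF (V u).toNNReal t ∂sphereUniform n) - gaussCDF 1 t =
      ∫ u, (gaussCDF (V u).toNNReal t - gaussCDF 1 t + κ * (V u - 1)) ∂sphereUniform n := by
    have hg' : Integrable (fun u ↦ gaussCDF (V u).toNNReal t - gaussCDF 1 t) (sphereUniform n) :=
      hg.sub (integrable_const _)
    rw [integral_add hg' hlin, integral_sub hg (integrable_const _),
      integral_const_mul, hmean]
    simp
  calc _ = ‖∫ u, (gaussCDF (V u).toNNReal t - gaussCDF 1 t + κ * (V u - 1)) ∂sphereUniform n‖ := by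
        rw [← heq, Real.norm_eq_abs]
    _ ≤ ∫ u, 66 * (V u - 1) ^ 2 ∂sphereUniform n :=
        norm_integral_le_of_norm_le (Continuous.integrable_sphereUniform hn
            (f := fun u ↦ 66 * (V u - 1) ^ 2) (by fun_prop))
          (Filter.Eventually.of_forall fun u ↦ abs_gaussCDF_toNNReal_sub_le t (hV0 u))
    _ ≤ 66 * (2 * (∑ k, b k ^ 2) / (n * (n + 2))) := by
        rw [integral_const_mul]
        gcongr
    _ = _ := by ring

/-- Inequality (1.8) of Remark 2.2: the average over `θ` of the distribution
function of `N_θ` is close to the standard Gaussian distribution function, at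
rate `(1 + α_n (log n)²)/n`. -/
theorem averaged_gauss_mixture_cdf_close_to_std :
    ∃ C : ℝ, 0 < C ∧
      ∀ (n : ℕ), 2 ≤ n → ∀ (b2 : Fin n → ℝ), (∀ k, 0 ≤ b2 k) →
        (∑ k, b2 k = (n : ℝ)) →
        ∀ (α : ℝ), (∀ k, (b2 k) ^ 2 ≤ α) →
        (⨆ t : ℝ,
          |(∫ u : Metric.sphere (0 : EuclideanSpace ℝ (Fin n)) 1,
              gaussCDF (Real.toNNReal (∑ k, ((u : EuclideanSpace ℝ (Fin n)) k) ^ 2 * b2 k)) t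
              ∂(sphereUniform n)) - gaussCDF 1 t|) ≤
          C * (1 + α * Real.log n ^ 2) / n := by
  refine ⟨300, by norm_num, fun n hn b2 hb hsum α hα ↦ ciSup_le fun t ↦ ?_⟩
  have hn0 : n ≠ 0 := by omega
  refine (abs_integral_gaussCDF_sub_le hn0 hb hsum t).trans ?_
  have hnR : (2 : ℝ) ≤ n := by exact_mod_cast hn
  have hα0 : 0 ≤ α := (sq_nonneg _).trans (hα ⟨0, by omega⟩)
  have hsq : ∑ k, b2 k ^ 2 ≤ n * α := by
    simpa using Finset.sum_le_sum fun k (_ : k ∈ Finset.univ) ↦ hα k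
  have hlog : 0.69 ≤ Real.log n :=
    (by linarith [Real.log_two_gt_d9] : (0.69 : ℝ) ≤ Real.log 2).trans
      (Real.log_le_log (by norm_num) hnR)
  have hlog2 : 0.47 ≤ Real.log n ^ 2 := by nlinarith
  calc 132 * (∑ k, b2 k ^ 2) / (n * (n + 2)) ≤ 132 * (n * α) / (n * n) := by
        gcongr
        linarith
    _ = 132 * α / n := by field_simp
    _ ≤ 300 * (1 + α * Real.log n ^ 2) / n := by
        refine div_le_div_of_nonneg_right ?_ (by positivity)
        nlinarith [mul_le_mul_of_nonneg_left hlog2 hα0]
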